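/- arXiv:math/0201157 — 5 statements merged into one kernel-verified Lean document; each statement's English description precedes it below -/
import Mathlib

section
/- Let ε = exp(2πi/3), S = diag(1, ε, ε²) ∈ M₃(ℂ), T ∈ M₃(ℂ) the permutation matrix with T e₁ = e₁, T e₂ = e₃, T e₃ = e₂, and define σ(g) = T ((S g S⁻¹)ᵗ)⁻¹ T⁻¹ on invertible 3×3 complex matrices. Then: (a) σ composed with itself six times is the identity on invertible matrices; and (b) for g ∈ SU₃ (i.e. g unitary with det g = 1), σ(g) = g if and only if g = diag(1, a, a⁻¹) for some complex number a with |a| = 1. -/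
open Matrix

/-- The automorphism `σ(g) = T ((S g S⁻¹)ᵗ)⁻¹ T⁻¹` of `SU₃` has order six
(its sixth iterate is the identity on invertible matrices) and its fixed
points in `SU₃` are exactly the matrices `diag(1, a, a⁻¹)` with `|a| = 1`. -/
theorem sigma_order_six_and_fixed_points
    (ε : ℂ) (hε : ε = Complex.exp (2 * Real.pi * Complex.I / 3))
    (S T : Matrix (Fin 3) (Fin 3) ℂ)
    (hS : S = Matrix.diagonal ![1, ε, ε ^ 2])
    (hT : T = ![![1, 0, 0], ![0, 0, 1], ![0, 1, 0]])
    (σ : Matrix (Fin 3) (Fin 3) ℂ → Matrix (Fin 3) (Fin 3) ℂ)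
    (hσ : ∀ g, σ g = T * ((S * g * S⁻¹)ᵀ)⁻¹ * T⁻¹) :
    (∀ g : Matrix (Fin 3) (Fin 3) ℂ, IsUnit g → σ (σ (σ (σ (σ (σ g))))) = g) ∧
    (∀ g : Matrix (Fin 3) (Fin 3) ℂ, g ∈ Matrix.unitaryGroup (Fin 3) ℂ → g.det = 1 →
      (σ g = g ↔ ∃ a : ℂ, ‖a‖ = 1 ∧ g = Matrix.diagonal ![1, a, a⁻¹])) := by
  have hprim : IsPrimitiveRoot ε 3 := by
    rw [hε]; exact_mod_cast Complex.isPrimitiveRoot_exp 3 (by norm_num)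
  have h3 : ε ^ 3 = 1 := hprim.pow_eq_one
  have h1 : ε ≠ 1 := hprim.ne_one (by norm_num)
  have h0 : ε ≠ 0 := hprim.ne_zero (by norm_num)
  have hT' : T = !![1, 0, 0; 0, 0, 1; 0, 1, 0] := hT
  have hTT : T * T = 1 := by
    rw [hT']; ext i j; fin_cases i <;> fin_cases j <;> simp [Matrix.mul_apply, Fin.sum_univ_three]
  have hTi : T⁻¹ = T := Matrix.inv_eq_right_inv hTT
  have hTt : Tᵀ = T := by
    rw [hT']; ext i j; fin_cases i <;> fin_cases j <;> simp
  have hSt : Sᵀ = S := by rw [hS]; simp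
  have h4 : ε ^ 2 * ε ^ 2 = ε := by linear_combination ε * h3
  have hSSS : S * (S * S) = 1 := by
    rw [hS, Matrix.diagonal_mul_diagonal, Matrix.diagonal_mul_diagonal, ← Matrix.diagonal_one]
    congr 1; ext i; fin_cases i
    · simp
    · simp; linear_combination h3
    · simp; linear_combination (ε ^ 3 + 1) * h3
  have hSi : S⁻¹ = S * S := Matrix.inv_eq_right_inv hSSS
  have hTD : ∀ a b c : ℂ, T * Matrix.diagonal ![a, b, c] * T = Matrix.diagonal ![a, c, b] := by
    intro a b c
    rw [hT']; ext i j; fin_cases i <;> fin_cases j <;>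
      simp [Matrix.mul_apply, Fin.sum_univ_three, Matrix.vecMul_diagonal]
  have hTST : T * S * T = S * S := by
    rw [hS, hTD, Matrix.diagonal_mul_diagonal]
    congr 1; ext i; fin_cases i
    · simp
    · simp; ring
    · simp; linear_combination -ε * h3
  have hTS : T * S = S * S * T := by
    rw [← hTST, Matrix.mul_assoc (T * S), hTT, Matrix.mul_one]
  have hform : ∀ g, σ g = S * T * (g⁻¹)ᵀ * T * (S * S) := by
    intro g
    have e1 : (S * S)⁻¹ = S := by
      apply Matrix.inv_eq_right_inv; rw [Matrix.mul_assoc]; exact hSSS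
    have e2 : T * (S * S) = S * T := by
      rw [← Matrix.mul_assoc, hTS, Matrix.mul_assoc, hTS]
      calc S * S * (S * S * T) = (S * (S * S)) * (S * T) := by simp only [Matrix.mul_assoc]
        _ = S * T := by rw [hSSS, Matrix.one_mul]
    have e3 : S * T = T * (S * S) := e2.symm
    have e4 : T * ((S * S) * (g⁻¹)ᵀ * S) * T = (T * (S * S)) * (g⁻¹)ᵀ * (S * T) := by
      simp only [Matrix.mul_assoc]
    rw [hσ, hSi, hTi, ← Matrix.transpose_nonsing_inv, Matrix.mul_inv_rev (S * g), e1, Matrix.mul_inv_rev, hSi,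
      Matrix.transpose_mul, Matrix.transpose_mul, Matrix.transpose_mul, hSt, e4, e2,
      Matrix.mul_assoc _ T (S * S), e2]
  have hSq : ∀ g : Matrix (Fin 3) (Fin 3) ℂ, IsUnit g → σ (σ g) = S * S * g * S := by
    intro g hg
    have hd : IsUnit g.det := (Matrix.isUnit_iff_isUnit_det g).1 hg
    have e1 : (S * S)⁻¹ = S := by
      apply Matrix.inv_eq_right_inv; rw [Matrix.mul_assoc]; exact hSSS
    have e5 : ((g⁻¹)ᵀ)⁻¹ = gᵀ := by
      rw [← Matrix.transpose_nonsing_inv, Matrix.nonsing_inv_nonsing_inv g hd]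
    rw [hform (σ g), hform g]
    simp only [Matrix.mul_inv_rev, hTi, hSi, e5, Matrix.transpose_mul, hTt, hSt, Matrix.transpose_transpose]
    have hSSS' : ∀ X : Matrix (Fin 3) (Fin 3) ℂ, S * (S * (S * X)) = X := by
      intro X
      calc _ = (S * (S * S)) * X := by simp only [Matrix.mul_assoc]
        _ = X := by rw [hSSS, Matrix.one_mul]
    have hTT' : ∀ X : Matrix (Fin 3) (Fin 3) ℂ, T * (T * X) = X := by
      intro X; rw [← Matrix.mul_assoc, hTT, Matrix.one_mul]
    have hTS' : ∀ X : Matrix (Fin 3) (Fin 3) ℂ, T * (S * X) = S * (S * (T * X)) := by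
      intro X; rw [← Matrix.mul_assoc, hTS]; simp only [Matrix.mul_assoc]
    simp only [Matrix.mul_assoc, hTS, hTS', hTT, hTT', hSSS, hSSS', Matrix.mul_one]
  have hSu : IsUnit S := IsUnit.of_mul_eq_one _ hSSS
  refine ⟨?_, ?_⟩
  · intro g hg
    have hu : ∀ g, IsUnit g → IsUnit (S * S * g * S) := fun g hg =>
      ((hSu.mul hSu).mul hg).mul hSu
    rw [hSq g hg, hSq _ (hu g hg), hSq _ (hu _ (hu g hg))]
    calc _ = (S * (S * S)) * (S * (S * S)) * g * (S * (S * S)) := by simp only [Matrix.mul_assoc]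
      _ = g := by rw [hSSS]; simp
  · intro g hgU hdet
    have hd : IsUnit g.det := by rw [hdet]; exact isUnit_one
    have hg : IsUnit g := (Matrix.isUnit_iff_isUnit_det g).2 hd
    have hdiag : ∀ a b c a' b' c' : ℂ, b * b' = 1 → c * c' = 1 → a * a' = 1 →
        σ (Matrix.diagonal ![a, b, c]) = Matrix.diagonal ![a', c', b'] := by
      intro a b c a' b' c' hb hc ha
      have hi : (Matrix.diagonal ![a, b, c])⁻¹ = Matrix.diagonal ![a', b', c'] := by
        apply Matrix.inv_eq_right_inv
        rw [Matrix.diagonal_mul_diagonal, ← Matrix.diagonal_one]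
        congr 1; ext i; fin_cases i <;> simp [ha, hb, hc]
      have hc : S * Matrix.diagonal ![a', c', b'] = Matrix.diagonal ![a', c', b'] * S := by
        rw [hS, Matrix.diagonal_mul_diagonal, Matrix.diagonal_mul_diagonal]
        congr 1; ext i; ring
      rw [hform, hi, Matrix.diagonal_transpose]
      calc _ = S * (T * Matrix.diagonal ![a', b', c'] * T) * (S * S) := by simp only [Matrix.mul_assoc]
        _ = _ := by rw [hTD, hc, Matrix.mul_assoc, hSSS, Matrix.mul_one]
    constructor
    · intro h
      have h2 : S * S * g * S = g := by rw [← hSq g hg, h, h]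
      have hcomm : S * g = g * S := by
        calc S * g = S * (S * S * g * S) := by rw [h2]
          _ = (S * (S * S)) * (g * S) := by simp only [Matrix.mul_assoc]
          _ = g * S := by rw [hSSS, Matrix.one_mul]
      have hent : ∀ i j, (![1, ε, ε ^ 2] : Fin 3 → ℂ) i * g i j = g i j * (![1, ε, ε ^ 2] : Fin 3 → ℂ) j := by
        intro i j
        have := congrFun (congrFun hcomm i) j
        rwa [hS, Matrix.diagonal_mul, Matrix.mul_diagonal] at this
      have hinj : Function.Injective (![1, ε, ε ^ 2] : Fin 3 → ℂ) := by
        have n1 : ε ^ 2 ≠ 1 := fun h => h1 (by linear_combination h3 - ε * h)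
        have n2 : ε ^ 2 ≠ ε := fun h => h1 (by
          apply mul_left_cancel₀ h0; linear_combination h)
        intro i j hij
        fin_cases i <;> fin_cases j <;> simp [h1, h1.symm, n1, n1.symm, n2, n2.symm, -pow_eq_one_iff] at hij ⊢
        all_goals first | exact h1 hij | exact h1 hij.symm | exact n1 hij | exact n1 hij.symm | exact n2 hij | exact n2 hij.symm
      have hoff : ∀ i j, i ≠ j → g i j = 0 := by
        intro i j hij
        have := hent i j
        by_contra hne
        exact hij (hinj (mul_left_cancel₀ hne (by rw [← this]; ring)))
      have hgd : g = Matrix.diagonal ![g 0 0, g 1 1, g 2 2] := by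
        ext i j; fin_cases i <;> fin_cases j <;> simp [Matrix.diagonal_apply] <;>
          exact hoff _ _ (by decide)
      generalize g 0 0 = a at hgd
      generalize g 1 1 = b at hgd
      generalize g 2 2 = c at hgd
      subst hgd
      have habc : a * b * c = 1 := by
        rw [Matrix.det_diagonal, Fin.prod_univ_three] at hdet; simpa using hdet
      have ha0 : a ≠ 0 := by rintro rfl; simp at habc
      have hb0 : b ≠ 0 := by rintro rfl; simp at habc
      have hU := (Matrix.mem_unitaryGroup_iff).1 hgU
      have hb1 : b * star b = 1 := by
        have := congrFun (congrFun hU 1) 1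
        simpa [Matrix.star_eq_conjTranspose, Matrix.diagonal_conjTranspose, Matrix.diagonal_mul_diagonal] using this
      have hnb : ‖b‖ = 1 := by
        have := congrArg norm hb1
        rw [norm_mul, norm_star, norm_one] at this
        nlinarith [norm_nonneg b]
      -- from the fixed point equation, c = b⁻¹
      have hcb : c * b = 1 := by
        have hc0 : c ≠ 0 := by rintro rfl; simp at habc
        rw [hdiag a b c a⁻¹ b⁻¹ c⁻¹ (mul_inv_cancel₀ hb0) (mul_inv_cancel₀ hc0) (mul_inv_cancel₀ ha0)] at h
        have := congrFun (congrFun h 1) 1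
        simp at this
        rw [← this, mul_inv_cancel₀ hc0]
      have ha : a = 1 := by linear_combination habc - a * hcb
      refine ⟨b, hnb, ?_⟩
      rw [ha, eq_inv_of_mul_eq_one_left hcb]
    · rintro ⟨a, ha, rfl⟩
      have ha0 : a ≠ 0 := by rintro rfl; simp at ha
      exact hdiag 1 a a⁻¹ 1 a⁻¹ a (by field_simp) (by field_simp) (by ring)
end

section
/- Let R ∈ M₃(ℝ) ⊂ M₃(ℂ) be the rotation matrix R = [[1,0,0],[0,cos(π/3),sin(π/3)],[0,−sin(π/3),cos(π/3)]] and define σ̂(g) = R (gᵗ)⁻¹ R⁻¹ on invertible 3×3 complex matrices. Then: (a) σ̂ composed with itself six times is the identity on invertible matrices; and (b) for g ∈ SU₃ (i.e. g unitary with det g = 1), σ̂(g) = g if and only if all entries of g are real and g e₁ = e₁ (equivalently, g is a real special orthogonal matrix fixing e₁, i.e. a rotation about the e₁-axis). -/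
open Matrix

lemma aux_comm (s : ℂ) (hs : s ^ 2 = 3 / 4) (g R : Matrix (Fin 3) (Fin 3) ℂ)
    (hR : R = !![1, 0, 0; 0, 1/2, s; 0, -s, 1/2]) (h : (R * R) * g = g * (R * R)) :
    g 0 1 = 0 ∧ g 0 2 = 0 ∧ g 1 0 = 0 ∧ g 2 0 = 0 ∧ g 2 1 = - g 1 2 ∧ g 2 2 = g 1 1 := by
  have hs0 : s ≠ 0 := by
    rintro rfl
    norm_num at hs
  have hRR : R * R = !![1, 0, 0; 0, -1/2, s; 0, -s, -1/2] := by
    subst hR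
    ext i j
    fin_cases i <;> fin_cases j <;> simp [Matrix.mul_apply, Fin.sum_univ_three] <;>
      grind
  rw [hRR] at h
  have e : ∀ i j, _ := fun i j => congrFun (congrFun h i) j
  have e01 := e 0 1
  have e02 := e 0 2
  have e10 := e 1 0
  have e20 := e 2 0
  have e11 := e 1 1
  have e12 := e 1 2
  simp [Matrix.mul_apply, Fin.sum_univ_three] at e01 e02 e10 e20 e11 e12
  refine ⟨?_, ?_, ?_, ?_, ?_, ?_⟩
  · grind
  · grind
  · grind
  · grind
  · apply mul_left_cancel₀ hs0
    linear_combination e11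
  · apply mul_left_cancel₀ hs0
    linear_combination e12

/-- For the rotation `R` about the `e₁`-axis through angle `π/3`, the outer
automorphism `σ̂(g) = R (gᵗ)⁻¹ R⁻¹` has sixth iterate the identity on
invertible matrices, and its fixed points in `SU₃` are exactly the real
special orthogonal matrices fixing `e₁` (i.e. `g` has real entries and
`g e₁ = e₁`). -/
theorem sigmaHat_order_six_and_fixed_points
    (R : Matrix (Fin 3) (Fin 3) ℂ)
    (hR : R = ![![1, 0, 0],
                ![0, (Real.cos (Real.pi / 3) : ℂ), (Real.sin (Real.pi / 3) : ℂ)],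
                ![0, -(Real.sin (Real.pi / 3) : ℂ), (Real.cos (Real.pi / 3) : ℂ)]])
    (σ : Matrix (Fin 3) (Fin 3) ℂ → Matrix (Fin 3) (Fin 3) ℂ)
    (hσ : ∀ g, σ g = R * (gᵀ)⁻¹ * R⁻¹) :
    (∀ g : Matrix (Fin 3) (Fin 3) ℂ, IsUnit g → σ (σ (σ (σ (σ (σ g))))) = g) ∧
    (∀ g : Matrix (Fin 3) (Fin 3) ℂ, g ∈ Matrix.unitaryGroup (Fin 3) ℂ → g.det = 1 →
      (σ g = g ↔ (∀ i j, (g i j).im = 0) ∧ g.mulVec ![1, 0, 0] = ![1, 0, 0])) := by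
  obtain ⟨s, hsdef⟩ : ∃ s : ℂ, s = (Real.sin (Real.pi / 3) : ℂ) := ⟨_, rfl⟩
  have hs : s ^ 2 = 3 / 4 := by
    rw [hsdef, ← Complex.ofReal_pow, Real.sin_pi_div_three, div_pow, Real.sq_sqrt (by norm_num)]
    norm_num
  have hR' : R = !![1, 0, 0; 0, 1/2, s; 0, -s, 1/2] := by
    rw [hR, ← hsdef, Real.cos_pi_div_three]
    ext i j
    fin_cases i <;> fin_cases j <;> simp
  have hstar : star s = s := by
    rw [hsdef]
    exact Complex.conj_ofReal _
  clear hR hsdef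
  have hRT : R * Rᵀ = 1 := by
    subst hR'
    ext i j
    fin_cases i <;> fin_cases j <;> simp [Matrix.mul_apply, Fin.sum_univ_three] <;>
      grind
  have hTR : Rᵀ * R = 1 := mul_eq_one_comm.mp hRT
  have hinv : R⁻¹ = Rᵀ := Matrix.inv_eq_right_inv hRT
  have hRc : R.map star = R := by
    subst hR'
    ext i j
    fin_cases i <;> fin_cases j <;> simp <;> first | exact hstar | exact Complex.conj_ofNat 2
  have hR3 : R * R * R = !![1, 0, 0; 0, -1, 0; 0, 0, -1] := by
    subst hR'
    ext i j
    fin_cases i <;> fin_cases j <;> simp [Matrix.mul_apply, Fin.sum_univ_three] <;> grind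
  have hR6 : (R * R * R) * (R * R * R) = 1 := by
    rw [hR3]
    ext i j
    fin_cases i <;> fin_cases j <;> simp [Matrix.mul_apply, Fin.sum_univ_three]
  constructor
  · have h2 : ∀ g, IsUnit g → σ (σ g) = R * R * g * (Rᵀ * Rᵀ) := by
      intro g hg
      have hgd : IsUnit g.det := (Matrix.isUnit_iff_isUnit_det g).mp hg
      have : ((σ g)ᵀ)⁻¹ = R * g * Rᵀ := by
        apply Matrix.inv_eq_right_inv
        rw [hσ, hinv]
        simp only [Matrix.transpose_mul, Matrix.transpose_transpose, Matrix.transpose_nonsing_inv]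
        calc R * (g⁻¹ * Rᵀ) * (R * g * Rᵀ) = R * (g⁻¹ * ((Rᵀ * R) * g)) * Rᵀ := by
              simp only [Matrix.mul_assoc]
          _ = 1 := by rw [hTR, Matrix.one_mul, Matrix.nonsing_inv_mul _ hgd, Matrix.mul_one, hRT]
      rw [hσ (σ g), this, hinv]
      simp only [Matrix.mul_assoc]
    have hRu : IsUnit R := IsUnit.of_mul_eq_one _ hRT
    have hRtu : IsUnit Rᵀ := IsUnit.of_mul_eq_one _ hTR
    have h2u : ∀ g, IsUnit g → IsUnit (σ (σ g)) := by
      intro g hg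
      rw [h2 g hg]
      exact ((hRu.mul hRu).mul hg).mul (hRtu.mul hRtu)
    intro g hg
    rw [h2 _ (h2u _ (h2u _ hg)), h2 _ (h2u _ hg), h2 _ hg]
    have hT6 : (Rᵀ * Rᵀ * Rᵀ) * (Rᵀ * Rᵀ * Rᵀ) = 1 := by
      have := congrArg Matrix.transpose hR6
      simpa [Matrix.transpose_mul, Matrix.mul_assoc] using this
    calc _ = ((R * R * R) * (R * R * R)) * g * ((Rᵀ * Rᵀ * Rᵀ) * (Rᵀ * Rᵀ * Rᵀ)) := by
          simp only [Matrix.mul_assoc]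
      _ = g := by rw [hR6, hT6, Matrix.one_mul, Matrix.mul_one]
  · intro g hg hdet
    have hgg : g * gᴴ = 1 := by
      simpa [Matrix.star_eq_conjTranspose] using (Matrix.mem_unitaryGroup_iff).mp hg
    have hgg' : gᴴ * g = 1 := mul_eq_one_comm.mp hgg
    have hgc : (gᵀ)⁻¹ = g.map star := by
      apply Matrix.inv_eq_right_inv
      have := congrArg Matrix.transpose hgg'
      simpa [Matrix.transpose_mul, Matrix.conjTranspose, Matrix.transpose_map] using this
    have hiff : σ g = g ↔ R * g.map star = g * R := by
      rw [hσ, hgc, hinv]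
      constructor
      · intro h
        conv_rhs => rw [← h]
        rw [Matrix.mul_assoc _ Rᵀ, hTR, Matrix.mul_one]
      · intro h
        rw [h, Matrix.mul_assoc, hRT, Matrix.mul_one]
    have hblock : g 0 1 = 0 ∧ g 0 2 = 0 ∧ g 1 0 = 0 ∧ g 2 0 = 0 ∧ g 2 1 = - g 1 2 ∧
        g 2 2 = g 1 1 → R * g = g * R := by
      rintro ⟨h1, h2, h3, h4, h5, h6⟩
      subst hR'
      ext i j
      fin_cases i <;> fin_cases j <;>
        simp [Matrix.mul_apply, Fin.sum_univ_three, h1, h2, h3, h4, h5, h6] <;> ring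
    have hreal : g.map star = g ↔ ∀ i j, (g i j).im = 0 := by
      constructor
      · intro h i j
        exact Complex.conj_eq_iff_im.mp (congrFun (congrFun h i) j)
      · intro h
        ext i j : 2
        exact Complex.conj_eq_iff_im.mpr (h i j)
    rw [hiff]
    constructor
    · intro h
      have h' : R * g = g.map star * R := by
        have := congrArg (fun M : Matrix (Fin 3) (Fin 3) ℂ => M.map (starRingEnd ℂ)) h
        simp only [Matrix.map_mul] at this
        have hc : R.map (starRingEnd ℂ) = R := hRc
        have hcc : (g.map star).map (starRingEnd ℂ) = g := by
          ext i j : 2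
          simp
        rw [hc, hcc] at this
        exact this
      have hcomm : (R * R) * g = g * (R * R) := by
        rw [Matrix.mul_assoc, h', ← Matrix.mul_assoc, h, Matrix.mul_assoc]
      have hb := aux_comm s hs g R hR' hcomm
      have hgr : g.map star = g := by
        have h3 := hblock hb
        rw [← h] at h3
        have h4 := congrArg (fun M => Rᵀ * M) h3
        simp only [← Matrix.mul_assoc, hTR, Matrix.one_mul] at h4
        exact h4.symm
      refine ⟨hreal.mp hgr, ?_⟩
      obtain ⟨h1, h2, h3, h4, h5, h6⟩ := hb
      have hgt : g * gᵀ = 1 := by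
        have : gᴴ = gᵀ := by
          ext i j : 2
          exact congrFun (congrFun hgr j) i
        rwa [this] at hgg
      have e11 := congrFun (congrFun hgt 1) 1
      simp [Matrix.mul_apply, Fin.sum_univ_three, h3] at e11
      rw [Matrix.det_fin_three, h1, h2, h3, h4, h5, h6] at hdet
      have h00 : g 0 0 = 1 := by linear_combination hdet - g 0 0 * e11
      ext i
      fin_cases i <;> simp [Matrix.mulVec, dotProduct, Fin.sum_univ_three, h00, h3, h4]
    · rintro ⟨hre, hv⟩
      have hgr := hreal.mpr hre
      rw [hgr]
      have hgH : gᴴ = gᵀ := by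
        ext i j : 2
        exact congrFun (congrFun hgr j) i
      rw [hgH] at hgg hgg'
      have v0 := congrFun hv 0
      have v1 := congrFun hv 1
      have v2 := congrFun hv 2
      simp [Matrix.mulVec, dotProduct, Fin.sum_univ_three] at v0 v1 v2
      have c01 := congrFun (congrFun hgg' 0) 1
      have c02 := congrFun (congrFun hgg' 0) 2
      have r11 := congrFun (congrFun hgg 1) 1
      have r12 := congrFun (congrFun hgg 1) 2
      simp [Matrix.mul_apply, Fin.sum_univ_three, v0, v1, v2] at c01 c02 r11 r12
      rw [Matrix.det_fin_three, v0, v1, v2, c01, c02] at hdet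
      refine hblock ⟨c01, c02, v1, v2, ?_, ?_⟩
      · linear_combination (-g 2 1) * r11 + g 1 1 * r12 - g 1 2 * hdet
      · linear_combination (-g 2 2) * r11 + g 1 2 * r12 + g 1 1 * hdet
end

section
/- Consider the ring ℂ[λ, λ⁻¹] of Laurent polynomials over ℂ and let ι be the ℂ-algebra automorphism determined by ι(λ) = −λ⁻¹ (so ι(λⁿ) = (−1)ⁿ λ⁻ⁿ); note ι is an involution. Then the fixed subalgebra {p ∈ ℂ[λ, λ⁻¹] : ι(p) = p} equals the ℂ-subalgebra generated by λ − λ⁻¹. -/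
open LaurentPolynomial in
theorem sum_mem_aux (n : ℕ) :
    (T (n : ℤ) + ((-1 : ℂ) ^ n) • T (-(n : ℤ)) : LaurentPolynomial ℂ) ∈
      Algebra.adjoin ℂ ({T 1 - T (-1)} : Set (LaurentPolynomial ℂ)) := by
  induction n using Nat.twoStepInduction with
  | zero =>
    simp only [Nat.cast_zero, neg_zero, pow_zero, one_smul, T_zero]
    exact add_mem (one_mem _) (one_mem _)
  | one =>
    have h := Algebra.self_mem_adjoin_singleton ℂ (T 1 - T (-1) : LaurentPolynomial ℂ)
    simpa [sub_eq_add_neg] using h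
  | more n h0 h1 =>
    have h := Algebra.self_mem_adjoin_singleton ℂ (T 1 - T (-1) : LaurentPolynomial ℂ)
    have e : (T ((n + 2 : ℕ) : ℤ) + ((-1 : ℂ) ^ (n + 2)) • T (-((n + 2 : ℕ) : ℤ)) :
        LaurentPolynomial ℂ) = (T 1 - T (-1)) *
        (T ((n + 1 : ℕ) : ℤ) + ((-1 : ℂ) ^ (n + 1)) • T (-((n + 1 : ℕ) : ℤ))) +
        (T (n : ℤ) + ((-1 : ℂ) ^ n) • T (-(n : ℤ))) := by
      simp only [sub_mul, mul_add, mul_smul_comm, ← T_add]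
      have e1 : (1 : ℤ) + ((n + 1 : ℕ) : ℤ) = ((n + 2 : ℕ) : ℤ) := by push_cast; ring
      have e2 : (1 : ℤ) + -((n + 1 : ℕ) : ℤ) = -(n : ℤ) := by push_cast; ring
      have e3 : (-1 : ℤ) + ((n + 1 : ℕ) : ℤ) = (n : ℤ) := by push_cast; ring
      have e4 : (-1 : ℤ) + -((n + 1 : ℕ) : ℤ) = -((n + 2 : ℕ) : ℤ) := by push_cast; ring
      rw [e1, e2, e3, e4]
      simp only [pow_succ]
      module
    rw [e]
    exact add_mem (mul_mem h h1) h0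

/-- For the ℂ-algebra automorphism `ι` of the Laurent polynomial ring
`ℂ[λ, λ⁻¹]` determined by `ι(λⁿ) = (-1)ⁿ λ⁻ⁿ`, the fixed subalgebra is
exactly the ℂ-subalgebra generated by `λ - λ⁻¹`. -/
theorem fixed_subalgebra_negated_inversion
    (ι : LaurentPolynomial ℂ ≃ₐ[ℂ] LaurentPolynomial ℂ)
    (hι : ∀ n : ℤ, ι (LaurentPolynomial.T n) =
      ((-1 : ℂ) ^ n) • LaurentPolynomial.T (-n)) :
    {p : LaurentPolynomial ℂ | ι p = p} =
      ↑(Algebra.adjoin ℂ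
        ({LaurentPolynomial.T 1 - LaurentPolynomial.T (-1)} :
          Set (LaurentPolynomial ℂ))) := by
  have key : ∀ p : LaurentPolynomial ℂ, p + ι p ∈ Algebra.adjoin ℂ
      ({LaurentPolynomial.T 1 - LaurentPolynomial.T (-1)} : Set (LaurentPolynomial ℂ)) := by
    intro p
    induction p using LaurentPolynomial.induction_on' with
    | add p q hp hq =>
      rw [map_add, add_add_add_comm]
      exact add_mem hp hq
    | C_mul_T n a =>
      rw [← LaurentPolynomial.smul_eq_C_mul, map_smul, ← smul_add, hι]
      refine Subalgebra.smul_mem _ ?_ _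
      obtain ⟨m, rfl | rfl⟩ := n.eq_nat_or_neg
      · simpa using sum_mem_aux m
      · have h := Subalgebra.smul_mem _ (sum_mem_aux m) ((-1 : ℂ) ^ m)
        rw [smul_add, smul_smul, ← mul_pow] at h
        simpa [add_comm, ← inv_pow] using h
  ext p
  simp only [Set.mem_setOf_eq, SetLike.mem_coe]
  constructor
  · intro hp
    have h := Subalgebra.smul_mem _ (key p) (1 / 2 : ℂ)
    rw [hp] at h
    convert h using 1
    module
  · intro hp
    induction hp using Algebra.adjoin_induction with
    | mem x hx =>
      rw [Set.mem_singleton_iff] at hx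
      subst hx
      rw [map_sub, hι, hι]
      simp only [zpow_one, zpow_neg, neg_neg]
      norm_num
      ring
    | algebraMap r => exact ι.commutes r
    | add x y _ _ hx hy => rw [map_add, hx, hy]
    | mul x y _ _ hx hy => rw [map_mul, hx, hy]
end

section
/- Let U = [[1,0,0],[0, 1/√2, −i/√2],[0, −1/√2, −i/√2]] ∈ M₃(ℂ), let ε = exp(2πi/3), S = diag(1, ε, ε²), and let T be the permutation matrix with T e₁ = e₁, T e₂ = e₃, T e₃ = e₂. Then: (a) U is unitary; (b) det U = −i; and (c) U⁻¹ · T · S · (Uᵗ)⁻¹ = [[1,0,0],[0, 1/2, √3/2],[0, −√3/2, 1/2]], the rotation of ℝ³ about the e₁-axis through angle π/3. -/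
open Matrix

/-- The matrix `U = [[1,0,0],[0,1/√2,−i/√2],[0,−1/√2,−i/√2]]` is unitary with
`det U = −i`, and `U⁻¹ T S (Uᵗ)⁻¹` is the rotation of `ℝ³` about the
`e₁`-axis through angle `π/3`, where `S = diag(1,ε,ε²)` with
`ε = exp(2πi/3)` and `T` is the permutation matrix swapping `e₂` and `e₃`. -/
theorem U_unitary_det_and_R
    (U : Matrix (Fin 3) (Fin 3) ℂ)
    (hU : U = ![![1, 0, 0],
                ![0, 1 / (Real.sqrt 2 : ℂ), -Complex.I / (Real.sqrt 2 : ℂ)],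
                ![0, -(1 / (Real.sqrt 2 : ℂ)), -Complex.I / (Real.sqrt 2 : ℂ)]])
    (ε : ℂ) (hε : ε = Complex.exp (2 * Real.pi * Complex.I / 3))
    (S T : Matrix (Fin 3) (Fin 3) ℂ)
    (hS : S = Matrix.diagonal ![1, ε, ε ^ 2])
    (hT : T = ![![1, 0, 0], ![0, 0, 1], ![0, 1, 0]]) :
    U ∈ Matrix.unitaryGroup (Fin 3) ℂ ∧
    U.det = -Complex.I ∧
    U⁻¹ * T * S * (Uᵀ)⁻¹ =
      ![![1, 0, 0],
        ![0, 1 / 2, (Real.sqrt 3 : ℂ) / 2],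
        ![0, -((Real.sqrt 3 : ℂ) / 2), 1 / 2]] := by
  have h2 : (Real.sqrt 2 : ℂ) ^ 2 = 2 := by
    rw [← Complex.ofReal_pow, Real.sq_sqrt (by norm_num)]; norm_num
  have h3 : (Real.sqrt 3 : ℂ) ^ 2 = 3 := by
    rw [← Complex.ofReal_pow, Real.sq_sqrt (by norm_num)]; norm_num
  have h20 : (Real.sqrt 2 : ℂ) ≠ 0 := by
    intro h; rw [h] at h2; norm_num at h2
  obtain ⟨a, ha⟩ : ∃ a : ℂ, a = (Real.sqrt 2 : ℂ)⁻¹ := ⟨_, rfl⟩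
  have ha2 : a ^ 2 = 1 / 2 := by rw [ha, inv_pow, h2]; norm_num
  have hca : (starRingEnd ℂ) a = a := by
    rw [ha, map_inv₀, Complex.conj_ofReal]
  have hI := Complex.I_sq
  have he : ε = -1 / 2 + (Real.sqrt 3 : ℂ) / 2 * Complex.I := by
    have e1 : (2 * Real.pi * Complex.I / 3 : ℂ) = ((Real.pi - Real.pi / 3 : ℝ) : ℂ) * Complex.I := by
      push_cast; ring
    rw [hε, e1, Complex.exp_mul_I, ← Complex.ofReal_cos, ← Complex.ofReal_sin,
      Real.cos_pi_sub, Real.sin_pi_sub, Real.cos_pi_div_three, Real.sin_pi_div_three]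
    push_cast; ring
  have he2 : ε ^ 2 = -1 / 2 - (Real.sqrt 3 : ℂ) / 2 * Complex.I := by
    rw [he]; linear_combination (1 / 4 : ℂ) * Complex.I ^ 2 * h3 + (3 / 4 : ℂ) * hI
  have hU' : U = !![1, 0, 0; 0, a, -Complex.I * a; 0, -a, -Complex.I * a] := by
    rw [hU, ha]; simp only [div_eq_mul_inv, one_mul]; rfl
  have hT' : T = !![1, 0, 0; 0, 0, 1; 0, 1, 0] := hT
  have hdet : U.det = -Complex.I := by
    rw [hU', Matrix.det_fin_three]; simp
    linear_combination (-2 * Complex.I) * ha2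
  have hu : IsUnit U.det := by rw [hdet]; simp
  have hut : IsUnit (Uᵀ).det := by rwa [Matrix.det_transpose]
  refine ⟨?_, hdet, ?_⟩
  · rw [Matrix.mem_unitaryGroup_iff, hU']
    ext i j
    fin_cases i <;> fin_cases j <;>
      simp [Matrix.mul_apply, Fin.sum_univ_three, Matrix.star_apply, hca]
    all_goals first
      | linear_combination (1 - Complex.I ^ 2) * ha2 - hI / 2
      | linear_combination (-1 - Complex.I ^ 2) * ha2 - hI / 2
  · change _ = !![1, 0, 0; 0, 1 / 2, (Real.sqrt 3 : ℂ) / 2; 0, -((Real.sqrt 3 : ℂ) / 2), 1 / 2]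
    have key : T * S = U * !![1, 0, 0; 0, 1 / 2, (Real.sqrt 3 : ℂ) / 2;
        0, -((Real.sqrt 3 : ℂ) / 2), 1 / 2] * Uᵀ := by
      rw [hS, hT', hU', he2, he]
      generalize (Real.sqrt 3 : ℂ) = s
      ext i j
      fin_cases i <;> fin_cases j <;>
        simp [Matrix.mul_apply, Fin.sum_univ_three, Matrix.diagonal]
      · linear_combination (-(1 + Complex.I ^ 2) / 2) * ha2 - hI / 4
      · linear_combination (-(-1 + Complex.I ^ 2) / 2 + s * Complex.I) * ha2 - hI / 4
      · linear_combination (-(-1 + Complex.I ^ 2) / 2 - s * Complex.I) * ha2 - hI / 4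
      · linear_combination (-(1 + Complex.I ^ 2) / 2) * ha2 - hI / 4
    rw [Matrix.mul_assoc U⁻¹, key, Matrix.mul_assoc U, Matrix.nonsing_inv_mul_cancel_left _ _ hu,
      Matrix.mul_nonsing_inv_cancel_right _ _ hut]
end

section
/- Let f : ℝ² → ℂ³ be twice continuously differentiable, and define the Wirtinger derivatives f_z = (1/2)(∂f/∂x − i ∂f/∂y) and f_z̄ = (1/2)(∂f/∂x + i ∂f/∂y). Suppose that at every point the Hermitian inner products satisfy ⟨f_z, f⟩ = 0 and ⟨f_z̄, f⟩ = 0. Then ‖f_z‖ = ‖f_z̄‖ at every point. -/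
/-- Let `f : ℝ² → ℂ³` be `C²` with Wirtinger derivatives
`f_z = (1/2)(f_x − i f_y)` and `f_z̄ = (1/2)(f_x + i f_y)`. If at every
point `⟨f_z, f⟩ = 0` and `⟨f_z̄, f⟩ = 0` for the Hermitian inner product on
`ℂ³`, then `‖f_z‖ = ‖f_z̄‖` at every point. -/
theorem norm_fz_eq_norm_fzbar
    (f : ℝ × ℝ → EuclideanSpace ℂ (Fin 3))
    (hf : ContDiff ℝ 2 f)
    (fz fzbar : ℝ × ℝ → EuclideanSpace ℂ (Fin 3))
    (hfz : ∀ p, fz p =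
      (1 / 2 : ℂ) • (fderiv ℝ f p (1, 0) - Complex.I • fderiv ℝ f p (0, 1)))
    (hfzbar : ∀ p, fzbar p =
      (1 / 2 : ℂ) • (fderiv ℝ f p (1, 0) + Complex.I • fderiv ℝ f p (0, 1)))
    (h1 : ∀ p, inner (𝕜 := ℂ) (f p) (fz p) = 0)
    (h2 : ∀ p, inner (𝕜 := ℂ) (f p) (fzbar p) = 0) :
    ∀ p, ‖fz p‖ = ‖fzbar p‖ := by
  intro p
  have hx : ∀ q, inner ℂ (f q) (fderiv ℝ f q (1, 0)) = 0 := by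
    intro q
    have e : fderiv ℝ f q (1, 0) = fz q + fzbar q := by
      rw [hfz, hfzbar]; module
    rw [e, inner_add_right, h1, h2, add_zero]
  have hy : ∀ q, inner ℂ (f q) (fderiv ℝ f q (0, 1)) = 0 := by
    intro q
    have e : Complex.I • fderiv ℝ f q (0, 1) = fzbar q - fz q := by
      rw [hfz, hfzbar]; module
    have e2 : inner ℂ (f q) (Complex.I • fderiv ℝ f q (0, 1)) = 0 := by
      rw [e, inner_sub_right, h1, h2, sub_zero]
    rw [inner_smul_right] at e2
    exact (mul_eq_zero.mp e2).resolve_left Complex.I_ne_zero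
  have hd : DifferentiableAt ℝ f p := hf.differentiable (by norm_num) p
  have hdd : DifferentiableAt ℝ (fderiv ℝ f) p :=
    (hf.fderiv_right (m := 1) (by norm_num)).differentiable (by norm_num) p
  have key : ∀ v w : ℝ × ℝ, (∀ q, inner ℂ (f q) (fderiv ℝ f q v) = 0) →
      inner ℂ (f p) (fderiv ℝ (fderiv ℝ f) p w v)
        + inner ℂ (fderiv ℝ f p w) (fderiv ℝ f p v) = 0 := by
    intro v w h
    have hg : HasFDerivAt (fun q => fderiv ℝ f q v) ((fderiv ℝ (fderiv ℝ f) p).flip v) p := by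
      simpa using hdd.hasFDerivAt.clm_apply (hasFDerivAt_const v p)
    have h3 := fderiv_inner_apply ℂ hd hg.differentiableAt w
    rw [hg.fderiv] at h3
    have h4 : (fun t => inner ℂ (f t) (fderiv ℝ f t v)) = fun _ => (0 : ℂ) := funext h
    rw [h4] at h3
    simpa using h3.symm
  have sym : fderiv ℝ (fderiv ℝ f) p (1, 0) (0, 1) = fderiv ℝ (fderiv ℝ f) p (0, 1) (1, 0) :=
    (hf.contDiffAt.isSymmSndFDerivAt (by simp)) (1, 0) (0, 1)
  have k1 := key (1, 0) (0, 1) hx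
  have k2 := key (0, 1) (1, 0) hy
  rw [sym] at k2
  have k3 : inner ℂ (fderiv ℝ f p (1, 0)) (fderiv ℝ f p (0, 1))
      = inner ℂ (fderiv ℝ f p (0, 1)) (fderiv ℝ f p (1, 0)) := by
    linear_combination k2 - k1
  have k4 : (inner ℂ (fderiv ℝ f p (1, 0)) (fderiv ℝ f p (0, 1))).im = 0 := by
    have := congrArg Complex.im k3
    rw [← inner_conj_symm (fderiv ℝ f p (0, 1)), Complex.conj_im] at this
    linarith
  rw [hfz, hfzbar, norm_smul, norm_smul]
  congr 1
  rw [← sq_eq_sq₀ (norm_nonneg _) (norm_nonneg _), @norm_sub_sq ℂ, @norm_add_sq ℂ,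
    inner_smul_right]
  simp [k4]
end
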